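/- arXiv:1706.04334 — 2 statements merged into one kernel-verified Lean document; each statement's English description precedes it below -/
import Mathlib

section
/- Let G be a connected graph decomposed into a path P and a cycle C, where C has length at most 5 and P contains at most three chords of C. Then pn(G) = 2. -/
/-- A path decomposition of `G`: a list of paths of `G` whose edge sets are pairwise
disjoint and whose union is the edge set of `G`. -/
def IsPathDecomp {V : Type} (G : SimpleGraph V)
    (P : List (Σ u : V, Σ v : V, G.Walk u v)) : Prop :=
  (∀ p ∈ P, p.2.2.IsPath) ∧
  (∀ e : Sym2 V, e ∈ G.edgeSet ↔ ∃ p ∈ P, e ∈ p.2.2.edges) ∧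
  P.Pairwise (fun p q => ∀ e, e ∈ p.2.2.edges → e ∉ q.2.2.edges)

/-- An edge of `G` is a chord of the cycle `C` if it is not an edge of `C` but joins
two (distinct) vertices of `C`. -/
def IsChord {V : Type} (G : SimpleGraph V) {w : V} (C : G.Walk w w) (e : Sym2 V) : Prop :=
  e ∈ G.edgeSet ∧ e ∉ C.edges ∧ ∃ a b : V, e = s(a, b) ∧ a ∈ C.support ∧ b ∈ C.support

/-- The list of consecutive pairs of a list, as unordered pairs. -/
def edgesL {α : Type} : List α → List (Sym2 α)
  | [] => []
  | [_] => []
  | a :: b :: l => s(a, b) :: edgesL (b :: l)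

theorem edgesL_append {α : Type} (A : List α) (a : α) (B : List α) :
    edgesL (A ++ a :: B) = edgesL (A ++ [a]) ++ edgesL (a :: B) := by
  induction A with
  | nil => simp [edgesL]
  | cons x A ih =>
    cases A with
    | nil => simp [edgesL]
    | cons y A => simpa [edgesL] using ih

theorem edgesL_reverse {α : Type} (A : List α) :
    (edgesL A.reverse).Perm (edgesL A) := by
  induction A with
  | nil => simp [edgesL]
  | cons x A ih =>
    cases A with
    | nil => simp [edgesL]
    | cons y A =>
      have h : (x :: y :: A).reverse = A.reverse ++ y :: [x] := by simp
      rw [h, edgesL_append]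
      simp only [List.reverse_cons] at ih
      simp only [edgesL]
      rw [Sym2.eq_swap (a := y) (b := x)]
      exact (List.perm_append_comm).trans (List.Perm.cons _ ih)

theorem edgesL_map {α β : Type} (f : α → β) (A : List α) :
    edgesL (A.map f) = (edgesL A).map (Sym2.map f) := by
  induction A with
  | nil => simp [edgesL]
  | cons x A ih =>
    cases A with
    | nil => simp [edgesL]
    | cons y A => simpa [edgesL] using ih

theorem mem_of_edgesL {α : Type} (A : List α) (x y : α) (h : s(x, y) ∈ edgesL A) :
    x ∈ A ∧ y ∈ A := by
  induction A with
  | nil => simp [edgesL] at h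
  | cons a A ih =>
    cases A with
    | nil => simp [edgesL] at h
    | cons b A =>
      simp only [edgesL, List.mem_cons, Sym2.eq_iff] at h
      grind

theorem edgesL_nodup {α : Type} (A : List α) (h : A.Nodup) : (edgesL A).Nodup := by
  induction A with
  | nil => simp [edgesL]
  | cons a A ih =>
    cases A with
    | nil => simp [edgesL]
    | cons b A =>
      simp only [edgesL, List.nodup_cons] at *
      refine ⟨fun hm => ?_, ih h.2⟩
      exact h.1 (mem_of_edgesL _ _ _ hm).1

theorem edgesL_split {α : Type} (L : List α) (a b : α) (h : s(a, b) ∈ edgesL L) :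
    ∃ A B, L = A ++ a :: b :: B ∨ L = A ++ b :: a :: B := by
  induction L with
  | nil => simp [edgesL] at h
  | cons x L ih =>
    cases L with
    | nil => simp [edgesL] at h
    | cons y L =>
      simp only [edgesL, List.mem_cons, Sym2.eq_iff] at h
      rcases h with (⟨rfl, rfl⟩ | ⟨rfl, rfl⟩) | h
      · exact ⟨[], L, Or.inl rfl⟩
      · exact ⟨[], L, Or.inr rfl⟩
      · obtain ⟨A, B, h | h⟩ := ih h
        · exact ⟨x :: A, B, Or.inl (by simp [h])⟩
        · exact ⟨x :: A, B, Or.inr (by simp [h])⟩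

/-- `P` together with the closed list `K` splits into two duplicate-free lists, with control
over the ends. -/
def Good {α : Type} (P K : List α) : Prop :=
  ∃ L₁ L₂ : List α, L₁.Nodup ∧ L₂.Nodup ∧
    (edgesL L₁ ++ edgesL L₂).Perm (edgesL P ++ edgesL K) ∧
    (∀ x ∈ L₁ ++ L₂, x ∈ P ∨ x ∈ K) ∧ L₁.head? = P.head? ∧
    (L₁.getLast? = P.getLast? ∨ L₂.getLast? = P.getLast?)

theorem Good.map {α β : Type} {P K : List α} (h : Good P K) (f : α → β)
    (hf : ∀ x y, (x ∈ P ∨ x ∈ K) → (y ∈ P ∨ y ∈ K) → f x = f y → x = y) :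
    Good (P.map f) (K.map f) := by
  obtain ⟨L₁, L₂, h1, h2, hp, hs, hh, hl⟩ := h
  refine ⟨L₁.map f, L₂.map f, ?_, ?_, ?_, ?_, ?_, ?_⟩
  · exact h1.map_on fun x hx y hy => hf x y (hs x (by simp [hx])) (hs y (by simp [hy]))
  · exact h2.map_on fun x hx y hy => hf x y (hs x (by simp [hx])) (hs y (by simp [hy]))
  · simp only [edgesL_map, ← List.map_append]
    exact hp.map _
  · intro x hx
    rw [← List.map_append, List.mem_map] at hx
    obtain ⟨y, hy, rfl⟩ := hx
    exact (hs y hy).imp (List.mem_map_of_mem) (List.mem_map_of_mem)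
  · simp [hh]
  · simp only [List.getLast?_map]
    exact hl.imp (congrArg _) (congrArg _)

theorem Good.reverse {α : Type} {P K : List α} (h : Good P K) : Good P.reverse K := by
  obtain ⟨L₁, L₂, h1, h2, hp, hs, hh, hl⟩ := h
  rcases hl with hl | hl
  · refine ⟨L₁.reverse, L₂, by simpa, h2, ?_, by simpa using hs, by simpa, Or.inl (by simpa)⟩
    exact ((edgesL_reverse _).append_right _).trans
      (hp.trans ((edgesL_reverse _).symm.append_right _))
  · refine ⟨L₂.reverse, L₁.reverse, by simpa, by simpa, ?_, ?_, by simpa, Or.inr (by simpa)⟩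
    · exact ((edgesL_reverse _).append (edgesL_reverse _)).trans (List.perm_append_comm.trans
        (hp.trans ((edgesL_reverse _).symm.append_right _)))
    · intro x hx
      have := hs x (by simp at hx ⊢; tauto)
      simpa using this

theorem Good.cons {α : Type} {a m : α} {P K : List α} (h : Good (a :: P) K)
    (hm : m ∉ a :: P) (hk : m ∉ K) : Good (m :: a :: P) K := by
  obtain ⟨L₁, L₂, h1, h2, hp, hs, hh, hl⟩ := h
  cases L₁ with
  | nil => simp at hh
  | cons b L =>
    simp only [List.head?_cons, Option.some.injEq] at hh
    subst hh
    refine ⟨m :: b :: L, L₂, ?_, h2, ?_, ?_, rfl, ?_⟩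
    · refine List.nodup_cons.2 ⟨fun h => ?_, h1⟩
      rcases hs m (by simp only [List.mem_append]; exact Or.inl h) with h | h
      · exact hm h
      · exact hk h
    · simpa [edgesL] using hp
    · intro x hx
      simp only [List.cons_append, List.mem_cons] at hx
      rcases hx with rfl | hx
      · simp
      · have := hs x (by simpa using hx)
        grind
    · simpa using hl

theorem edgesL_insert {α : Type} (A B : List α) (a m b : α) :
    (s(a, b) :: edgesL (A ++ a :: m :: b :: B)).Perm
      (s(a, m) :: s(m, b) :: edgesL (A ++ a :: b :: B)) := by
  rw [edgesL_append A a, edgesL_append A a (b :: B)]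
  simp only [edgesL]
  classical
  rw [List.perm_iff_count]
  intro x
  simp only [List.count_cons, List.count_append]
  omega

theorem insert_one {α : Type} (L : List α) (a m b : α) (h : s(a, b) ∈ edgesL L) (hL : L.Nodup)
    (hm : m ∉ L) : ∃ L' : List α, L'.Nodup ∧ (∀ x, x ∈ L' ↔ x ∈ L ∨ x = m) ∧
      L'.head? = L.head? ∧ L'.getLast? = L.getLast? ∧
      (s(a, b) :: edgesL L').Perm (s(a, m) :: s(m, b) :: edgesL L) := by
  obtain ⟨A, B, rfl | rfl⟩ := edgesL_split L a b h
  · refine ⟨A ++ a :: m :: b :: B, by grind, by grind, by cases A <;> simp, by simp,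
      edgesL_insert _ _ _ _ _⟩
  · refine ⟨A ++ b :: m :: a :: B, by grind, by grind, by cases A <;> simp, by simp, ?_⟩
    rw [Sym2.eq_swap (a := a) (b := b), Sym2.eq_swap (a := a) (b := m),
      Sym2.eq_swap (a := m) (b := b)]
    exact (edgesL_insert _ _ _ _ _).trans (List.Perm.swap _ _ _)

theorem perm_combine {α : Type} (p q r : α) (E1 E1' E2 EP EP' EK : List α)
    (h1 : (p :: E1').Perm (q :: r :: E1)) (h2 : (p :: EP').Perm (q :: r :: EP))
    (h : (E1 ++ E2).Perm (EP ++ EK)) : (E1' ++ E2).Perm (EP' ++ EK) := by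
  classical
  rw [List.perm_iff_count] at *
  intro x
  have a1 := h1 x
  have a2 := h2 x
  have a3 := h x
  simp only [List.count_cons, List.count_append] at *
  omega

theorem Good.insert_mid {α : Type} {A B : List α} {a m b : α} {K : List α}
    (h : Good (A ++ a :: b :: B) K) (hm : m ∉ A ++ a :: b :: B) (hk : m ∉ K) :
    Good (A ++ a :: m :: b :: B) K := by
  obtain ⟨L₁, L₂, h1, h2, hp, hs, hh, hl⟩ := h
  have hm1 : m ∉ L₁ := fun h => by
    rcases hs m (by simp [h]) with h | h
    · exact hm h
    · exact hk h
  have hm2 : m ∉ L₂ := fun h => by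
    rcases hs m (by simp [h]) with h | h
    · exact hm h
    · exact hk h
  have hP := edgesL_insert A B a m b
  have hmem : s(a, b) ∈ edgesL L₁ ++ edgesL L₂ := by
    rw [hp.mem_iff, edgesL_append]
    simp [edgesL]
  have hhead : (A ++ a :: m :: b :: B).head? = (A ++ a :: b :: B).head? := by
    cases A <;> simp
  have hlast : (A ++ a :: m :: b :: B).getLast? = (A ++ a :: b :: B).getLast? := by simp
  rw [List.mem_append] at hmem
  rcases hmem with hmem | hmem
  · obtain ⟨L', n', m', e1, e2, pe⟩ := insert_one L₁ a m b hmem h1 hm1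
    refine ⟨L', L₂, n', h2, perm_combine _ _ _ _ _ _ _ _ _ pe hP hp, ?_, ?_, ?_⟩
    · intro x hx
      have := hs x
      grind
    · rw [e1, hh, hhead]
    · rw [e2, hlast]; exact hl
  · obtain ⟨L', n', m', e1, e2, pe⟩ := insert_one L₂ a m b hmem h2 hm2
    refine ⟨L₁, L', h1, n', ?_, ?_, ?_, ?_⟩
    · exact List.perm_append_comm.trans
        (perm_combine _ _ _ _ _ _ _ _ _ pe hP (List.perm_append_comm.trans hp))
    · intro x hx
      have := hs x
      grind
    · rw [hh, hhead]
    · rw [e2, hlast]; exact hl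

theorem Good.insert {α : Type} {A B : List α} {m : α} {K : List α}
    (h : Good (A ++ B) K) (hne : A ++ B ≠ []) (hm : m ∉ A ++ B) (hk : m ∉ K) :
    Good (A ++ m :: B) K := by
  cases B with
  | nil =>
    have h' := h.reverse
    have hm' : m ∉ (A ++ []).reverse := by simpa using hm
    have hne' : (A ++ []).reverse ≠ [] := by simpa using hne
    revert h' hm' hne'
    generalize hR : (A ++ []).reverse = R
    intro h' hm' hne'
    cases R with
    | nil => exact absurd rfl hne'
    | cons a R =>
      have h3 := (h'.cons hm' hk).reverse
      rw [← hR] at h3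
      simpa using h3
  | cons b B =>
    rcases List.eq_nil_or_concat A with rfl | ⟨A', a, rfl⟩
    · exact Good.cons (by simpa using h) (by simpa using hm) hk
    · have := Good.insert_mid (A := A') (B := B) (a := a) (m := m) (b := b) (K := K)
        (by simpa using h) (by simpa using hm) hk
      simpa using this

theorem Good.sublist {α : Type} {K : List α} {Q P : List α} (hs : Q.Sublist P) :
    ∀ A : List α, (A ++ P).Nodup → (A ++ Q ≠ []) → (∀ x ∈ A ++ P, x ∈ K → x ∈ A ++ Q) →
      Good (A ++ Q) K → Good (A ++ P) K := by
  induction hs with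
  | slnil => intro A _ _ _ h; exact h
  | @cons Q P m hs ih =>
    intro A hn hne hk h
    have hsub := hs.subset
    have g := ih A (by grind) hne (by grind) h
    refine g.insert (by grind) (by grind) (by grind)
  | @cons_cons Q P m hs ih =>
    intro A hn hne hk h
    have := ih (A ++ [m]) (by simpa using hn) (by simp) (by simpa using hk) (by simpa using h)
    simpa using this

/-- Insert fresh numbers `k, k+1, …` between consecutive entries related by `g`. -/
def padL (g : ℕ → ℕ → Bool) : List ℕ → ℕ → List ℕ
  | [], _ => []
  | [a], _ => [a]
  | a :: b :: l, k => if g a b then a :: k :: padL g (b :: l) (k + 1) else a :: padL g (b :: l) k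

/-- Which pairs get subdivided: the neighbours in the `n`-cycle, and one more ordered pair. -/
def gapB (n : ℕ) (e : ℕ × ℕ) (a b : ℕ) : Bool :=
  ((a + 1) % n == b || (b + 1) % n == a) || (a == e.1 && b == e.2)

/-- The extra pairs to be tried. -/
def extraE (Q : List ℕ) : List (ℕ × ℕ) :=
  if Q.length = 5 then Q.zip Q.tail else [(0, 0)]

/-- The reduced shapes of a path meeting an `n`-cycle first at the vertex `0`. -/
def templates (n : ℕ) : List (ℕ × List ℕ) :=
  (List.range' 1 (n - 1)).sublists'.flatMap fun S => S.permutations'.flatMap fun R =>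
    (extraE (0 :: R)).map fun e => (n, padL (gapB n e) (0 :: R) n)

/-- Explicit decompositions of all reduced shapes: `(n, path, first part, second part)`. -/
def decTable : List (ℕ × List ℕ × List ℕ × List ℕ) := [
  (3, [0], [0, 1], [1, 2, 0]),
  (3, [0, 3, 2], [0, 1, 2, 3], [3, 0, 2]),
  (3, [0, 3, 1], [0, 1, 2], [2, 0, 3, 1]),
  (3, [0, 3, 1, 4, 2], [0, 1, 2, 4], [4, 1, 3, 0, 2]),
  (3, [0, 3, 2, 4, 1], [0, 1, 2, 3], [3, 0, 2, 4, 1]),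
  (4, [0], [0, 1], [1, 2, 3, 0]),
  (4, [0, 4, 3], [0, 1, 2, 3, 4], [4, 0, 3]),
  (4, [0, 2], [0, 1, 2, 3], [3, 0, 2]),
  (4, [0, 2, 4, 3], [0, 1, 2, 3, 4], [4, 2, 0, 3]),
  (4, [0, 4, 3, 5, 2], [0, 1, 2, 3, 4], [4, 0, 3, 5, 2]),
  (4, [0, 4, 1], [0, 1, 2], [2, 3, 0, 4, 1]),
  (4, [0, 4, 1, 3], [0, 1, 3, 2], [2, 1, 4, 0, 3]),
  (4, [0, 4, 3, 1], [0, 1, 2, 3, 4], [4, 0, 3, 1]),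
  (4, [0, 4, 1, 5, 2], [0, 1, 2, 3], [3, 0, 4, 1, 5, 2]),
  (4, [0, 2, 4, 1], [0, 1, 2, 3], [3, 0, 2, 4, 1]),
  (4, [0, 4, 1, 5, 2, 6, 3], [0, 1, 2, 3, 6], [6, 2, 5, 1, 4, 0, 3]),
  (4, [0, 2, 4, 1, 3], [0, 1, 3, 2, 4], [4, 1, 2, 0, 3]),
  (4, [0, 2, 4, 3, 1], [0, 1, 2, 3, 4], [4, 2, 0, 3, 1]),
  (4, [0, 4, 1, 3, 5, 2], [0, 1, 3, 2, 5], [5, 3, 0, 4, 1, 2]),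
  (4, [0, 4, 3, 1, 5, 2], [0, 1, 2, 3, 4], [4, 0, 3, 1, 5, 2]),
  (4, [0, 4, 3, 5, 2, 6, 1], [0, 1, 2, 3, 4], [4, 0, 3, 5, 2, 6, 1]),
  (5, [0], [0, 1], [1, 2, 3, 4, 0]),
  (5, [0, 5, 4], [0, 1, 2, 3, 4, 5], [5, 0, 4]),
  (5, [0, 3], [0, 1, 2, 3, 4], [4, 0, 3]),
  (5, [0, 3, 5, 4], [0, 1, 2, 3, 4, 5], [5, 3, 0, 4]),
  (5, [0, 5, 4, 6, 3], [0, 1, 2, 3, 4, 5], [5, 0, 4, 6, 3]),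
  (5, [0, 2], [0, 1, 2, 3], [3, 4, 0, 2]),
  (5, [0, 2, 4], [0, 1, 2, 4, 3], [3, 2, 0, 4]),
  (5, [0, 5, 4, 2], [0, 1, 2, 3, 4, 5], [5, 0, 4, 2]),
  (5, [0, 2, 5, 3], [0, 1, 2, 3, 4], [4, 0, 2, 5, 3]),
  (5, [0, 3, 5, 2], [0, 1, 2, 3, 4], [4, 0, 3, 5, 2]),
  (5, [0, 2, 5, 3, 6, 4], [0, 1, 2, 3, 4, 6], [6, 3, 5, 2, 0, 4]),
  (5, [0, 3, 5, 2, 4], [0, 1, 2, 4, 3, 5], [5, 2, 3, 0, 4]),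
  (5, [0, 3, 5, 4, 2], [0, 1, 2, 3, 4, 5], [5, 3, 0, 4, 2]),
  (5, [0, 2, 4, 5, 3], [0, 1, 2, 4, 3, 5], [5, 4, 0, 2, 3]),
  (5, [0, 5, 4, 2, 6, 3], [0, 1, 2, 3, 4, 5], [5, 0, 4, 2, 6, 3]),
  (5, [0, 5, 4, 6, 3, 7, 2], [0, 1, 2, 3, 4, 5], [5, 0, 4, 6, 3, 7, 2]),
  (5, [0, 5, 1], [0, 1, 2], [2, 3, 4, 0, 5, 1]),
  (5, [0, 5, 1, 4], [0, 1, 4, 3], [3, 2, 1, 5, 0, 4]),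
  (5, [0, 5, 4, 1], [0, 1, 2, 3, 4, 5], [5, 0, 4, 1]),
  (5, [0, 5, 1, 3], [0, 1, 2, 3, 4], [4, 0, 5, 1, 3]),
  (5, [0, 3, 1], [0, 1, 2, 3, 4], [4, 0, 3, 1]),
  (5, [0, 5, 1, 3, 6, 4], [0, 1, 2, 3, 4, 6], [6, 3, 1, 5, 0, 4]),
  (5, [0, 3, 1, 4], [0, 1, 4, 3, 2], [2, 1, 3, 0, 4]),
  (5, [0, 3, 5, 4, 1], [0, 1, 2, 3, 4, 5], [5, 3, 0, 4, 1]),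
  (5, [0, 5, 1, 4, 6, 3], [0, 1, 4, 3, 2], [2, 1, 5, 0, 4, 6, 3]),
  (5, [0, 5, 4, 1, 3], [0, 1, 2, 3, 4, 5], [5, 0, 4, 1, 3]),
  (5, [0, 5, 4, 6, 3, 1], [0, 1, 2, 3, 4, 5], [5, 0, 4, 6, 3, 1]),
  (5, [0, 5, 1, 6, 2], [0, 1, 2, 3], [3, 4, 0, 5, 1, 6, 2]),
  (5, [0, 2, 5, 1], [0, 1, 2, 3], [3, 4, 0, 2, 5, 1]),
  (5, [0, 5, 1, 6, 2, 4], [0, 1, 2, 4, 3], [3, 2, 6, 1, 5, 0, 4]),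
  (5, [0, 2, 5, 1, 4], [0, 1, 4, 3, 2, 5], [5, 1, 2, 0, 4]),
  (5, [0, 2, 4, 1], [0, 1, 2, 4, 3], [3, 2, 0, 4, 1]),
  (5, [0, 5, 1, 4, 2], [0, 1, 4, 2, 3], [3, 4, 0, 5, 1, 2]),
  (5, [0, 5, 4, 1, 6, 2], [0, 1, 2, 3, 4, 5], [5, 0, 4, 1, 6, 2]),
  (5, [0, 5, 4, 2, 6, 1], [0, 1, 2, 3, 4, 5], [5, 0, 4, 2, 6, 1]),
  (5, [0, 5, 1, 6, 2, 7, 3], [0, 1, 2, 3, 4], [4, 0, 5, 1, 6, 2, 7, 3]),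
  (5, [0, 2, 5, 1, 3], [0, 1, 2, 3, 4], [4, 0, 2, 5, 1, 3]),
  (5, [0, 2, 5, 3, 1], [0, 1, 2, 3, 4], [4, 0, 2, 5, 3, 1]),
  (5, [0, 5, 1, 3, 6, 2], [0, 1, 2, 3, 4], [4, 0, 5, 1, 3, 6, 2]),
  (5, [0, 3, 1, 5, 2], [0, 1, 2, 3, 4], [4, 0, 3, 1, 5, 2]),
  (5, [0, 3, 5, 2, 6, 1], [0, 1, 2, 3, 4], [4, 0, 3, 5, 2, 6, 1]),
  (5, [0, 5, 1, 6, 2, 7, 3, 8, 4], [0, 1, 2, 3, 4, 8], [8, 3, 7, 2, 6, 1, 5, 0, 4]),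
  (5, [0, 5, 1, 6, 2, 7, 3, 8, 4], [0, 1, 2, 3, 4, 8], [8, 3, 7, 2, 6, 1, 5, 0, 4]),
  (5, [0, 5, 1, 6, 2, 7, 3, 8, 4], [0, 1, 2, 3, 4, 8], [8, 3, 7, 2, 6, 1, 5, 0, 4]),
  (5, [0, 5, 1, 6, 2, 7, 3, 8, 4], [0, 1, 2, 3, 4, 8], [8, 3, 7, 2, 6, 1, 5, 0, 4]),
  (5, [0, 5, 2, 6, 1, 3, 7, 4], [0, 1, 2, 3, 4, 7], [7, 3, 1, 6, 2, 5, 0, 4]),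
  (5, [0, 2, 5, 1, 3, 6, 4], [0, 1, 2, 3, 4, 6], [6, 3, 1, 5, 2, 0, 4]),
  (5, [0, 2, 5, 1, 6, 3, 7, 4], [0, 1, 2, 3, 4, 7], [7, 3, 6, 1, 5, 2, 0, 4]),
  (5, [0, 2, 5, 1, 3, 6, 4], [0, 1, 2, 3, 4, 6], [6, 3, 1, 5, 2, 0, 4]),
  (5, [0, 5, 2, 6, 3, 1, 4], [0, 1, 4, 3, 2, 6], [6, 3, 1, 2, 5, 0, 4]),
  (5, [0, 2, 5, 3, 1, 4], [0, 1, 4, 3, 2, 5], [5, 3, 1, 2, 0, 4]),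
  (5, [0, 2, 5, 3, 6, 1, 4], [0, 1, 4, 3, 2, 5], [5, 3, 6, 1, 2, 0, 4]),
  (5, [0, 2, 5, 3, 1, 6, 4], [0, 1, 2, 3, 4, 6], [6, 1, 3, 5, 2, 0, 4]),
  (5, [0, 5, 2, 6, 3, 7, 4, 1], [0, 1, 2, 3, 4, 7], [7, 3, 6, 2, 5, 0, 4, 1]),
  (5, [0, 2, 5, 3, 6, 4, 1], [0, 1, 2, 3, 4, 6], [6, 3, 5, 2, 0, 4, 1]),
  (5, [0, 2, 5, 3, 6, 4, 1], [0, 1, 2, 3, 4, 6], [6, 3, 5, 2, 0, 4, 1]),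
  (5, [0, 2, 5, 3, 6, 4, 7, 1], [0, 1, 2, 3, 4, 6], [6, 3, 5, 2, 0, 4, 7, 1]),
  (5, [0, 5, 1, 3, 6, 2, 4], [0, 1, 2, 4, 3, 6], [6, 2, 3, 1, 5, 0, 4]),
  (5, [0, 5, 1, 6, 3, 7, 2, 4], [0, 1, 2, 4, 3, 7], [7, 2, 3, 6, 1, 5, 0, 4]),
  (5, [0, 5, 1, 3, 6, 2, 4], [0, 1, 2, 4, 3, 6], [6, 2, 3, 1, 5, 0, 4]),
  (5, [0, 5, 1, 3, 6, 2, 7, 4], [0, 1, 2, 3, 4, 7], [7, 2, 6, 3, 1, 5, 0, 4]),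
  (5, [0, 5, 3, 1, 6, 2, 4], [0, 1, 3, 4, 2, 6], [6, 1, 2, 3, 5, 0, 4]),
  (5, [0, 3, 5, 1, 6, 2, 4], [0, 1, 2, 4, 3, 5], [5, 1, 6, 2, 3, 0, 4]),
  (5, [0, 3, 1, 5, 2, 4], [0, 1, 3, 4, 2, 5], [5, 1, 2, 3, 0, 4]),
  (5, [0, 3, 1, 5, 2, 6, 4], [0, 1, 2, 3, 4, 6], [6, 2, 5, 1, 3, 0, 4]),
  (5, [0, 5, 3, 6, 2, 7, 1, 4], [0, 1, 4, 3, 2, 7], [7, 1, 2, 6, 3, 5, 0, 4]),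
  (5, [0, 3, 5, 2, 6, 1, 4], [0, 1, 4, 3, 2, 6], [6, 1, 2, 5, 3, 0, 4]),
  (5, [0, 3, 5, 2, 6, 1, 4], [0, 1, 4, 3, 2, 6], [6, 1, 2, 5, 3, 0, 4]),
  (5, [0, 3, 5, 2, 6, 1, 7, 4], [0, 1, 2, 3, 4, 7], [7, 1, 6, 2, 5, 3, 0, 4]),
  (5, [0, 5, 3, 6, 2, 4, 1], [0, 1, 2, 4, 3, 6], [6, 2, 3, 5, 0, 4, 1]),
  (5, [0, 3, 5, 2, 4, 1], [0, 1, 2, 4, 3, 5], [5, 2, 3, 0, 4, 1]),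
  (5, [0, 3, 5, 2, 6, 4, 1], [0, 1, 2, 3, 4, 6], [6, 2, 5, 3, 0, 4, 1]),
  (5, [0, 3, 5, 2, 4, 6, 1], [0, 1, 2, 4, 3, 5], [5, 2, 3, 0, 4, 6, 1]),
  (5, [0, 5, 1, 3, 6, 4, 2], [0, 1, 2, 3, 4, 6], [6, 3, 1, 5, 0, 4, 2]),
  (5, [0, 5, 1, 6, 3, 7, 4, 2], [0, 1, 2, 3, 4, 7], [7, 3, 6, 1, 5, 0, 4, 2]),
  (5, [0, 5, 1, 3, 6, 4, 2], [0, 1, 2, 3, 4, 6], [6, 3, 1, 5, 0, 4, 2]),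
  (5, [0, 5, 1, 3, 6, 4, 7, 2], [0, 1, 2, 3, 4, 6], [6, 3, 1, 5, 0, 4, 7, 2]),
  (5, [0, 5, 3, 1, 4, 2], [0, 1, 2, 4, 3, 5], [5, 0, 4, 1, 3, 2]),
  (5, [0, 3, 5, 1, 4, 2], [0, 1, 2, 4, 3, 5], [5, 1, 4, 0, 3, 2]),
  (5, [0, 3, 1, 5, 4, 2], [0, 1, 2, 3, 4, 5], [5, 1, 3, 0, 4, 2]),
  (5, [0, 3, 1, 4, 5, 2], [0, 1, 4, 3, 2, 5], [5, 4, 0, 3, 1, 2]),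
  (5, [0, 5, 3, 6, 4, 1, 7, 2], [0, 1, 2, 3, 4, 6], [6, 3, 5, 0, 4, 1, 7, 2]),
  (5, [0, 3, 5, 4, 1, 6, 2], [0, 1, 2, 3, 4, 5], [5, 3, 0, 4, 1, 6, 2]),
  (5, [0, 3, 5, 4, 6, 1, 7, 2], [0, 1, 2, 3, 4, 5], [5, 3, 0, 4, 6, 1, 7, 2]),
  (5, [0, 3, 5, 4, 1, 6, 2], [0, 1, 2, 3, 4, 5], [5, 3, 0, 4, 1, 6, 2]),
  (5, [0, 5, 3, 6, 4, 2, 7, 1], [0, 1, 2, 3, 4, 6], [6, 3, 5, 0, 4, 2, 7, 1]),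
  (5, [0, 3, 5, 4, 2, 6, 1], [0, 1, 2, 3, 4, 5], [5, 3, 0, 4, 2, 6, 1]),
  (5, [0, 3, 5, 4, 6, 2, 7, 1], [0, 1, 2, 3, 4, 5], [5, 3, 0, 4, 6, 2, 7, 1]),
  (5, [0, 3, 5, 4, 2, 6, 1], [0, 1, 2, 3, 4, 5], [5, 3, 0, 4, 2, 6, 1]),
  (5, [0, 5, 1, 6, 2, 4, 7, 3], [0, 1, 2, 4, 3, 7], [7, 4, 0, 5, 1, 6, 2, 3]),
  (5, [0, 5, 1, 6, 2, 4, 7, 3], [0, 1, 2, 4, 3, 7], [7, 4, 0, 5, 1, 6, 2, 3]),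
  (5, [0, 5, 1, 6, 2, 7, 4, 8, 3], [0, 1, 2, 3, 4, 7], [7, 2, 6, 1, 5, 0, 4, 8, 3]),
  (5, [0, 5, 1, 6, 2, 4, 7, 3], [0, 1, 2, 4, 3, 7], [7, 4, 0, 5, 1, 6, 2, 3]),
  (5, [0, 5, 2, 6, 1, 4, 7, 3], [0, 1, 4, 3, 2, 6], [6, 1, 2, 5, 0, 4, 7, 3]),
  (5, [0, 2, 5, 1, 4, 6, 3], [0, 1, 4, 3, 2, 5], [5, 1, 2, 0, 4, 6, 3]),
  (5, [0, 2, 5, 1, 6, 4, 7, 3], [0, 1, 2, 3, 4, 6], [6, 1, 5, 2, 0, 4, 7, 3]),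
  (5, [0, 2, 5, 1, 4, 6, 3], [0, 1, 4, 3, 2, 5], [5, 1, 2, 0, 4, 6, 3]),
  (5, [0, 5, 2, 4, 1, 3], [0, 1, 4, 3, 2, 5], [5, 0, 4, 2, 1, 3]),
  (5, [0, 2, 5, 4, 1, 3], [0, 1, 2, 3, 4, 5], [5, 2, 0, 4, 1, 3]),
  (5, [0, 2, 4, 5, 1, 3], [0, 1, 3, 2, 4, 5], [5, 1, 2, 0, 4, 3]),
  (5, [0, 2, 4, 1, 5, 3], [0, 1, 2, 4, 3, 5], [5, 1, 4, 0, 2, 3]),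
  (5, [0, 5, 2, 4, 6, 3, 1], [0, 1, 2, 4, 3, 6], [6, 4, 0, 5, 2, 3, 1]),
  (5, [0, 2, 5, 4, 6, 3, 1], [0, 1, 2, 3, 4, 5], [5, 2, 0, 4, 6, 3, 1]),
  (5, [0, 2, 4, 5, 3, 1], [0, 1, 2, 4, 3, 5], [5, 4, 0, 2, 3, 1]),
  (5, [0, 2, 4, 5, 3, 6, 1], [0, 1, 2, 4, 3, 5], [5, 4, 0, 2, 3, 6, 1]),
  (5, [0, 5, 1, 4, 2, 6, 3], [0, 1, 4, 2, 3, 6], [6, 2, 1, 5, 0, 4, 3]),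
  (5, [0, 5, 1, 6, 4, 2, 7, 3], [0, 1, 2, 3, 4, 6], [6, 1, 5, 0, 4, 2, 7, 3]),
  (5, [0, 5, 1, 4, 6, 2, 7, 3], [0, 1, 4, 3, 2, 6], [6, 4, 0, 5, 1, 2, 7, 3]),
  (5, [0, 5, 1, 4, 2, 6, 3], [0, 1, 4, 2, 3, 6], [6, 2, 1, 5, 0, 4, 3]),
  (5, [0, 5, 4, 1, 6, 2, 7, 3], [0, 1, 2, 3, 4, 5], [5, 0, 4, 1, 6, 2, 7, 3]),
  (5, [0, 5, 4, 6, 1, 7, 2, 8, 3], [0, 1, 2, 3, 4, 5], [5, 0, 4, 6, 1, 7, 2, 8, 3]),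
  (5, [0, 5, 4, 1, 6, 2, 7, 3], [0, 1, 2, 3, 4, 5], [5, 0, 4, 1, 6, 2, 7, 3]),
  (5, [0, 5, 4, 1, 6, 2, 7, 3], [0, 1, 2, 3, 4, 5], [5, 0, 4, 1, 6, 2, 7, 3]),
  (5, [0, 5, 4, 2, 6, 1, 3], [0, 1, 2, 3, 4, 5], [5, 0, 4, 2, 6, 1, 3]),
  (5, [0, 5, 4, 6, 2, 7, 1, 3], [0, 1, 2, 3, 4, 5], [5, 0, 4, 6, 2, 7, 1, 3]),
  (5, [0, 5, 4, 2, 6, 1, 3], [0, 1, 2, 3, 4, 5], [5, 0, 4, 2, 6, 1, 3]),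
  (5, [0, 5, 4, 2, 6, 1, 7, 3], [0, 1, 2, 3, 4, 5], [5, 0, 4, 2, 6, 1, 7, 3]),
  (5, [0, 5, 4, 2, 6, 3, 1], [0, 1, 2, 3, 4, 5], [5, 0, 4, 2, 6, 3, 1]),
  (5, [0, 5, 4, 6, 2, 7, 3, 1], [0, 1, 2, 3, 4, 5], [5, 0, 4, 6, 2, 7, 3, 1]),
  (5, [0, 5, 4, 2, 6, 3, 1], [0, 1, 2, 3, 4, 5], [5, 0, 4, 2, 6, 3, 1]),
  (5, [0, 5, 4, 2, 6, 3, 7, 1], [0, 1, 2, 3, 4, 5], [5, 0, 4, 2, 6, 3, 7, 1]),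
  (5, [0, 5, 1, 4, 6, 3, 7, 2], [0, 1, 4, 3, 2, 7], [7, 3, 6, 4, 0, 5, 1, 2]),
  (5, [0, 5, 1, 6, 4, 7, 3, 8, 2], [0, 1, 2, 3, 4, 6], [6, 1, 5, 0, 4, 7, 3, 8, 2]),
  (5, [0, 5, 1, 4, 6, 3, 7, 2], [0, 1, 4, 3, 2, 7], [7, 3, 6, 4, 0, 5, 1, 2]),
  (5, [0, 5, 1, 4, 6, 3, 7, 2], [0, 1, 4, 3, 2, 7], [7, 3, 6, 4, 0, 5, 1, 2]),
  (5, [0, 5, 4, 1, 3, 6, 2], [0, 1, 2, 3, 4, 5], [5, 0, 4, 1, 3, 6, 2]),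
  (5, [0, 5, 4, 6, 1, 3, 7, 2], [0, 1, 2, 3, 4, 5], [5, 0, 4, 6, 1, 3, 7, 2]),
  (5, [0, 5, 4, 1, 6, 3, 7, 2], [0, 1, 2, 3, 4, 5], [5, 0, 4, 1, 6, 3, 7, 2]),
  (5, [0, 5, 4, 1, 3, 6, 2], [0, 1, 2, 3, 4, 5], [5, 0, 4, 1, 3, 6, 2]),
  (5, [0, 5, 4, 6, 3, 1, 7, 2], [0, 1, 2, 3, 4, 5], [5, 0, 4, 6, 3, 1, 7, 2]),
  (5, [0, 5, 4, 6, 3, 1, 7, 2], [0, 1, 2, 3, 4, 5], [5, 0, 4, 6, 3, 1, 7, 2]),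
  (5, [0, 5, 4, 6, 3, 7, 1, 8, 2], [0, 1, 2, 3, 4, 5], [5, 0, 4, 6, 3, 7, 1, 8, 2]),
  (5, [0, 5, 4, 6, 3, 1, 7, 2], [0, 1, 2, 3, 4, 5], [5, 0, 4, 6, 3, 1, 7, 2]),
  (5, [0, 5, 4, 6, 3, 7, 2, 8, 1], [0, 1, 2, 3, 4, 5], [5, 0, 4, 6, 3, 7, 2, 8, 1]),
  (5, [0, 5, 4, 6, 3, 7, 2, 8, 1], [0, 1, 2, 3, 4, 5], [5, 0, 4, 6, 3, 7, 2, 8, 1]),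
  (5, [0, 5, 4, 6, 3, 7, 2, 8, 1], [0, 1, 2, 3, 4, 5], [5, 0, 4, 6, 3, 7, 2, 8, 1]),
  (5, [0, 5, 4, 6, 3, 7, 2, 8, 1], [0, 1, 2, 3, 4, 5], [5, 0, 4, 6, 3, 7, 2, 8, 1])]

/-- The conditions of `Good`, as a decidable check. -/
def chkT (t : ℕ × List ℕ × List ℕ × List ℕ) : Prop :=
  t.2.2.1.Nodup ∧ t.2.2.2.Nodup ∧
    (edgesL t.2.2.1 ++ edgesL t.2.2.2).Perm (edgesL t.2.1 ++ edgesL (List.range t.1 ++ [0])) ∧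
    (∀ x ∈ t.2.2.1 ++ t.2.2.2, x ∈ t.2.1 ∨ x ∈ List.range t.1 ++ [0]) ∧
    t.2.2.1.head? = t.2.1.head? ∧
    (t.2.2.1.getLast? = t.2.1.getLast? ∨ t.2.2.2.getLast? = t.2.1.getLast?)

instance (t : ℕ × List ℕ × List ℕ × List ℕ) : Decidable (chkT t) := by
  unfold chkT; infer_instance

theorem chk_table : ∀ t ∈ decTable, chkT t := by decide +kernel

theorem templates_eq :
    [3, 4, 5].flatMap templates = decTable.map fun t => (t.1, t.2.1) := by decide +kernel

theorem good_template (n : ℕ) (hn : n ∈ [3, 4, 5]) (T : List ℕ) (hT : (n, T) ∈ templates n) :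
    Good T (List.range n ++ [0]) := by
  have h : (n, T) ∈ [3, 4, 5].flatMap templates := List.mem_flatMap.2 ⟨n, hn, hT⟩
  rw [templates_eq, List.mem_map] at h
  obtain ⟨⟨n', T', L₁, L₂⟩, ht, he⟩ := h
  simp only [Prod.mk.injEq] at he
  obtain ⟨rfl, rfl⟩ := he
  exact ⟨L₁, L₂, chk_table _ ht⟩

theorem good_pad (n : ℕ) (hn : n ∈ [3, 4, 5]) (R : List ℕ) (hR : (0 :: R).Nodup)
    (hlt : ∀ i ∈ R, i < n) (e : ℕ × ℕ) (he : e ∈ extraE (0 :: R)) :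
    Good (padL (gapB n e) (0 :: R) n) (List.range n ++ [0]) := by
  refine good_template n hn _ ?_
  have hsub : R ⊆ List.range' 1 (n - 1) := by
    intro i hi
    have h1 := hlt i hi
    have h2 : i ≠ 0 := by rintro rfl; exact (List.nodup_cons.1 hR).1 hi
    rw [List.mem_range'_1]
    omega
  obtain ⟨S, hS, hSs⟩ := (List.nodup_cons.1 hR).2.subperm hsub
  simp only [templates, List.mem_flatMap, List.mem_map]
  exact ⟨S, List.mem_sublists'.2 hSs, R, List.mem_permutations'.2 hS.symm, e, he, rfl⟩

theorem mem_padL (g : ℕ → ℕ → Bool) (i : ℕ) : ∀ (Q : List ℕ) (k : ℕ), i ∈ Q → i ∈ padL g Q k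
  | [], _, h => by simp at h
  | [a], _, h => by simpa [padL] using h
  | a :: b :: l, k, h => by
    have h1 := mem_padL g i (b :: l) k
    have h2 := mem_padL g i (b :: l) (k + 1)
    rw [padL]
    split <;> simp only [List.mem_cons] at * <;> tauto

theorem weave {V : Type} (n : ℕ) (g : ℕ → ℕ → Bool) (c : ℕ → V) (d : V) (q : V → Bool) (N : ℕ) :
    ∀ (P : List V) (Q : List ℕ) (X : List V), P.length ≤ N → Q.map c = P.filter q →
      (∀ i ∈ Q, i < n) → n ≤ X.length → (∀ i < n, X.getD i d = c i) →
      (∀ a ∈ Q, ∀ b ∈ Q, g a b = true → s(c a, c b) ∉ edgesL P) →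
      ∃ M : List V, M.Sublist P ∧ (∀ m ∈ M, q m = false) ∧
        (∀ i ∈ padL g Q X.length, i < (X ++ M).length) ∧
        ((padL g Q X.length).map fun i => (X ++ M).getD i d).Sublist P := by
  induction N with
  | zero =>
    intro P Q X hN hQ _ _ _ _
    have hP : P = [] := List.length_eq_zero_iff.1 (by omega)
    subst hP
    have hQ' : Q = [] := by simpa using hQ
    subst hQ'
    exact ⟨[], by simp, by simp, by simp [padL], by simp [padL]⟩
  | succ N ih =>
    intro P Q X hN hQ hlt hX hXc hg
    cases P with
    | nil =>
      have hQ' : Q = [] := by simpa using hQ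
      subst hQ'
      exact ⟨[], by simp, by simp, by simp [padL], by simp [padL]⟩
    | cons x R =>
      have hsubE : ∀ e, e ∈ edgesL R → e ∈ edgesL (x :: R) := by
        intro e he
        cases R with
        | nil => simp [edgesL] at he
        | cons y R => simp only [edgesL, List.mem_cons] at he ⊢; tauto
      simp only [List.length_cons] at hN
      by_cases hx : q x = true
      · rw [List.filter_cons_of_pos hx] at hQ
        cases Q with
        | nil => simp at hQ
        | cons i Q =>
          simp only [List.map_cons, List.cons.injEq] at hQ
          obtain ⟨hi, hQ⟩ := hQ
          have hin : i < n := hlt i (by simp)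
          have hget : ∀ M : List V, (X ++ M).getD i d = x := by
            intro M
            rw [List.getD_append _ _ _ _ (by omega), hXc i hin, hi]
          cases Q with
          | nil =>
            refine ⟨[], by simp, by simp, ?_, ?_⟩
            · simp only [padL, List.mem_singleton, List.append_nil]
              rintro _ rfl
              omega
            · simp only [padL, List.map_cons, List.map_nil, hget]
              simp
          | cons j Q =>
            by_cases hgij : g i j = true
            · cases R with
              | nil => simp at hQ
              | cons y R =>
                have hy : ¬ q y = true := by
                  intro hy
                  rw [List.filter_cons_of_pos hy] at hQ
                  simp only [List.map_cons, List.cons.injEq] at hQ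
                  apply hg i (by simp) j (by simp) hgij
                  simp [edgesL, hi, hQ.1]
                rw [List.filter_cons_of_neg hy] at hQ
                simp only [List.length_cons] at hN
                have hsubE' : ∀ e, e ∈ edgesL R → e ∈ edgesL (y :: R) := by
                  intro e he
                  cases R with
                  | nil => simp [edgesL] at he
                  | cons y R => simp only [edgesL, List.mem_cons] at he ⊢; tauto
                obtain ⟨M, hM1, hM2, hM3, hM4⟩ := ih R (j :: Q) (X ++ [y]) (by omega) hQ
                  (fun i hi => hlt i (List.mem_cons_of_mem _ hi)) (by simp; omega)
                  (fun i hi => by rw [List.getD_append _ _ _ _ (by omega), hXc i hi])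
                  (fun a ha b hb hab he => hg a (List.mem_cons_of_mem _ ha) b
                    (List.mem_cons_of_mem _ hb) hab (hsubE _ (hsubE' _ he)))
                have hap : X ++ [y] ++ M = X ++ y :: M := by simp
                have hlen : (X ++ [y]).length = X.length + 1 := by simp
                rw [hap, hlen] at hM3 hM4
                refine ⟨y :: M, (hM1.cons_cons y).cons x, ?_, ?_, ?_⟩
                · intro m hm
                  rcases List.mem_cons.1 hm with rfl | hm
                  · simpa using hy
                  · exact hM2 m hm
                · rw [padL, if_pos hgij]
                  intro k hk
                  rcases List.mem_cons.1 hk with rfl | hk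
                  · simp; omega
                  rcases List.mem_cons.1 hk with rfl | hk
                  · simp
                  exact hM3 k hk
                · rw [padL, if_pos hgij]
                  simp only [List.map_cons, hget]
                  have hyy : (X ++ y :: M).getD X.length d = y := by
                    simp [List.getD_eq_getElem?_getD]
                  rw [hyy]
                  exact (hM4.cons_cons y).cons_cons x
            · obtain ⟨M, hM1, hM2, hM3, hM4⟩ := ih R (j :: Q) X (by omega) hQ
                (fun i hi => hlt i (List.mem_cons_of_mem _ hi)) hX hXc
                (fun a ha b hb hab he => hg a (List.mem_cons_of_mem _ ha) b
                    (List.mem_cons_of_mem _ hb) hab (hsubE _ he))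
              refine ⟨M, hM1.cons x, hM2, ?_, ?_⟩
              · rw [padL, if_neg hgij]
                intro k hk
                rcases List.mem_cons.1 hk with rfl | hk
                · simp; omega
                exact hM3 k hk
              · rw [padL, if_neg hgij]
                simp only [List.map_cons, hget]
                exact hM4.cons_cons x
      · rw [List.filter_cons_of_neg hx] at hQ
        obtain ⟨M, hM1, hM2, hM3, hM4⟩ := ih R Q X (by omega) hQ hlt hX hXc
          (fun a ha b hb hab he => hg a ha b hb hab (hsubE _ he))
        exact ⟨M, hM1.cons x, hM2, hM3, hM4.cons x⟩

theorem edgesL_eq_zip {V : Type} (c : ℕ → V) (Q : List ℕ) :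
    edgesL (Q.map c) = (Q.zip Q.tail).map fun e => s(c e.1, c e.2) := by
  induction Q with
  | nil => simp [edgesL]
  | cons x Q ih =>
    cases Q with
    | nil => simp [edgesL]
    | cons y Q => simpa [edgesL] using ih

theorem edges_eq_edgesL {V : Type} {G : SimpleGraph V} {u v : V} (p : G.Walk u v) :
    p.edges = edgesL p.support := by
  induction p with
  | nil => simp [edgesL]
  | cons h p ih =>
    cases p with
    | nil => simp [edgesL]
    | cons h' p => simpa [edgesL] using ih

theorem walk_of_list {V : Type} {G : SimpleGraph V} (d : V) (L : List V) (hL : L.Nodup)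
    (hE : ∀ e ∈ edgesL L, e ∈ G.edgeSet) :
    ∃ (u v : V) (p : G.Walk u v), p.IsPath ∧ p.edges = edgesL L := by
  cases L with
  | nil => exact ⟨d, d, .nil, by simp, by simp [edgesL]⟩
  | cons a L =>
    suffices h : ∃ (v : V) (p : G.Walk a v), p.support = a :: L by
      obtain ⟨v, p, hp⟩ := h
      refine ⟨a, v, p, ?_, by rw [edges_eq_edgesL, hp]⟩
      rw [SimpleGraph.Walk.isPath_def, hp]
      exact hL
    clear hL
    induction L generalizing a with
    | nil => exact ⟨a, .nil, by simp⟩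
    | cons b L ih =>
      obtain ⟨v, p, hp⟩ := ih b (fun e he => hE e (by simp [edgesL, he]))
      have hab : G.Adj a b := hE s(a, b) (by simp [edgesL])
      exact ⟨v, .cons hab p, by simp [hp]⟩

theorem getVert_edge {V : Type} {G : SimpleGraph V} {u v : V} (p : G.Walk u v) (i : ℕ)
    (hi : i < p.length) : s(p.getVert i, p.getVert (i + 1)) ∈ p.edges := by
  have h := p.toSubgraph_adj_getVert hi
  rwa [← SimpleGraph.Subgraph.mem_edgeSet, SimpleGraph.Walk.mem_edges_toSubgraph] at h

theorem path_no_cycle {V : Type} {G : SimpleGraph V} {a b : V} (p : G.Walk a b)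
    (hp : p.IsPath) : ∀ (w : V) (C : G.Walk w w), C.IsCycle → ¬ ∀ e ∈ C.edges, e ∈ p.edges := by
  classical
  induction p with
  | nil =>
    intro w C hC h
    have h3 := hC.three_le_length
    have := h _ (getVert_edge C 0 (by omega))
    simp at this
  | @cons a x b hax q ih =>
    intro w C hC h
    rw [SimpleGraph.Walk.cons_isPath_iff] at hp
    by_cases ha : a ∈ C.support
    · have hC' : (C.rotate a ha).IsCycle := by simpa using hC
      have hE : ∀ e ∈ (C.rotate a ha).edges, e ∈ (SimpleGraph.Walk.cons hax q).edges :=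
        fun e he => h e ((C.rotate_edges a ha).mem_iff.1 he)
      generalize C.rotate a ha = D at hC' hE
      have h3 := hC'.three_le_length
      have key : ∀ y, s(a, y) ∈ D.edges → y = x := by
        intro y hy
        have := hE _ hy
        rw [SimpleGraph.Walk.edges_cons, List.mem_cons] at this
        rcases this with h | h
        · have h' := Sym2.congr_right.1 h
          exact h'
        · exact absurd (q.fst_mem_support_of_mem_edges h) hp.2
      have e1 := getVert_edge D 0 (by omega)
      have e2 := getVert_edge D (D.length - 1) (by omega)
      rw [SimpleGraph.Walk.getVert_zero] at e1
      rw [show D.length - 1 + 1 = D.length by omega, SimpleGraph.Walk.getVert_length,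
        Sym2.eq_swap] at e2
      have k := (key _ e1).trans (key _ e2).symm
      have := hC'.getVert_injOn' (by rw [Set.mem_ofPred]; omega) (by rw [Set.mem_ofPred]) k
      omega
    · refine ih hp.1 w C hC fun e he => ?_
      have := h e he
      rw [SimpleGraph.Walk.edges_cons, List.mem_cons] at this
      rcases this with rfl | h
      · exact absurd (C.fst_mem_support_of_mem_edges he) ha
      · exact h

theorem support_eq_map {V : Type} {G : SimpleGraph V} {w : V} (C : G.Walk w w) :
    C.support = (List.range C.length ++ [0]).map C.getVert := by
  have h : C.support = (List.range (C.length + 1)).map C.getVert := by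
    apply List.ext_getElem
    · simp
    · intro i h1 h2
      simp [SimpleGraph.Walk.support_getElem_eq_getVert]
  rw [h, List.range_succ]
  simp

theorem good_main {V : Type} [DecidableEq V] (G : SimpleGraph V)
    {u v w : V} (P : G.Walk u v) (C : G.Walk w w)
    (hP : P.IsPath) (hC : C.IsCycle) (hlen : C.length ≤ 5)
    (hdisj : ∀ e ∈ P.edges, e ∉ C.edges)
    (hchord : {e : Sym2 V | e ∈ P.edges ∧ IsChord G C e}.ncard ≤ 3)
    (F : List V) (hF : P.support.filter (fun x => decide (x ∈ C.support)) = w :: F) :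
    Good P.support C.support := by
  have h3 := hC.three_le_length
  obtain ⟨n, hn⟩ : ∃ n, n = C.length := ⟨_, rfl⟩
  set c := C.getVert with hc
  have hinj : ∀ i < n, ∀ j < n, c i = c j → i = j := by
    intro i hi j hj hij
    exact hC.getVert_injOn' (by rw [Set.mem_ofPred]; omega) (by rw [Set.mem_ofPred]; omega) hij
  have hK : C.support = (List.range n ++ [0]).map c := by rw [hn]; exact support_eq_map C
  have hex : ∀ x ∈ C.support, ∃ i < n, c i = x := by
    intro x hx
    rw [hK, List.mem_map] at hx
    obtain ⟨i, hi, rfl⟩ := hx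
    refine ⟨i, ?_, rfl⟩
    simp only [List.mem_append, List.mem_range, List.mem_singleton] at hi
    omega
  have hFC : ∀ x ∈ F, x ∈ C.support := by
    intro x hx
    have : x ∈ P.support.filter (fun x => decide (x ∈ C.support)) := by rw [hF]; simp [hx]
    simpa using (List.mem_filter.1 this).2
  obtain ⟨R, hRF, hRn⟩ : ∃ R : List ℕ, R.map c = F ∧ ∀ i ∈ R, i < n := by
    clear hF
    induction F with
    | nil => exact ⟨[], by simp, by simp⟩
    | cons x F ih =>
      obtain ⟨R, h1, h2⟩ := ih fun y hy => hFC y (List.mem_cons_of_mem _ hy)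
      obtain ⟨i, hi, hx⟩ := hex x (hFC x (by simp))
      exact ⟨i :: R, by simp [h1, hx], by simpa [hi] using h2⟩
  have hc0 : c 0 = w := by simp [hc]
  have hQ : (0 :: R).map c = P.support.filter (fun x => decide (x ∈ C.support)) := by
    rw [hF, List.map_cons, hRF, hc0]
  have hQn : ∀ i ∈ 0 :: R, i < n := by
    intro i hi
    rcases List.mem_cons.1 hi with rfl | hi
    · omega
    · exact hRn i hi
  have hPn : P.support.Nodup := hP.support_nodup
  have hQmn : ((0 :: R).map c).Nodup := by rw [hQ]; exact hPn.filter _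
  have hQnd : (0 :: R).Nodup := List.Nodup.of_map c hQmn
  have hcS : ∀ i, c i ∈ C.support := fun i => C.getVert_mem_support i
  obtain ⟨e, he, hee⟩ : ∃ e ∈ extraE (0 :: R), s(c e.1, c e.2) ∉ P.edges := by
    by_cases h5 : (0 :: R).length = 5
    · rw [extraE, if_pos h5]
      by_contra hcon
      push Not at hcon
      have hsub : ∀ x ∈ edgesL ((0 :: R).map c),
          x ∈ {e : Sym2 V | e ∈ P.edges ∧ IsChord G C e} := by
        intro x hx
        rw [edgesL_eq_zip, List.mem_map] at hx
        obtain ⟨p, hp, rfl⟩ := hx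
        have hpe := hcon p hp
        exact ⟨hpe, P.edges_subset_edgeSet hpe, hdisj _ hpe, _, _, rfl, hcS _, hcS _⟩
      have hfin : {e : Sym2 V | e ∈ P.edges ∧ IsChord G C e}.Finite :=
        (List.finite_toSet P.edges).subset fun x hx => hx.1
      have hcard : (edgesL ((0 :: R).map c)).toFinset.card = 4 := by
        rw [List.toFinset_card_of_nodup (edgesL_nodup _ hQmn), edgesL_eq_zip]
        simp only [List.length_cons] at h5
        simp
        omega
      have hle : ((edgesL ((0 :: R).map c)).toFinset : Set (Sym2 V)).ncard ≤
          {e : Sym2 V | e ∈ P.edges ∧ IsChord G C e}.ncard :=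
        Set.ncard_le_ncard (fun x hx => hsub x (by simpa using hx)) hfin
      rw [Set.ncard_coe_finset, hcard] at hle
      omega
    · refine ⟨(0, 0), by rw [extraE, if_neg h5]; simp, fun h => ?_⟩
      have := P.edges_subset_edgeSet h
      simp at this
  have hadj : ∀ i < n, s(c i, c ((i + 1) % n)) ∈ C.edges := by
    intro i hi
    have h := getVert_edge C i (by omega)
    by_cases hi' : i + 1 = n
    · rw [hi', Nat.mod_self, hc0]
      rw [hi', hn, SimpleGraph.Walk.getVert_length] at h
      exact h
    · rw [Nat.mod_eq_of_lt (by omega)]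
      exact h
  have hXl : ((List.range n).map c).length = n := by simp
  obtain ⟨M, hM1, hM2, hM3, hM4⟩ := weave n (gapB n e) c w
    (fun x => decide (x ∈ C.support)) P.support.length P.support (0 :: R) ((List.range n).map c)
    le_rfl hQ hQn (by simp) (by intro i hi; simp [List.getD_eq_getElem?_getD, hi]) (by
      intro a ha b hb hab
      rw [← edges_eq_edgesL]
      simp only [gapB, Bool.or_eq_true, beq_iff_eq, Bool.and_eq_true] at hab
      rcases hab with (rfl | rfl) | ⟨rfl, rfl⟩
      · exact fun h => hdisj _ h (hadj a (hQn a ha))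
      · rw [Sym2.eq_swap]
        exact fun h => hdisj _ h (hadj b (hQn b hb))
      · exact hee)
  rw [hXl] at hM3 hM4
  have hXM : ((List.range n).map c ++ M).Nodup := by
    refine List.Nodup.append ?_ (hM1.nodup hPn) ?_
    · exact List.Nodup.map_on (fun i hi j hj => hinj i (List.mem_range.1 hi) j
        (List.mem_range.1 hj)) List.nodup_range
    · intro x hx hxM
      obtain ⟨i, _, rfl⟩ := List.mem_map.1 hx
      have := hM2 _ hxM
      simp only [decide_eq_false_iff_not] at this
      exact this (hcS i)
  set f : ℕ → V := fun i => ((List.range n).map c ++ M).getD i w with hf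
  have hfc : ∀ i < n, f i = c i := by
    intro i hi
    rw [hf]
    simp only
    rw [List.getD_append _ _ _ _ (by simpa using hi)]
    simp [List.getD_eq_getElem?_getD, hi]
  have hnm : n ∈ [3, 4, 5] := by simp; omega
  have g0 := good_pad n hnm R hQnd hRn e he
  have g1 := g0.map f (by
    have hb : ∀ x, x ∈ padL (gapB n e) (0 :: R) n ∨ x ∈ List.range n ++ [0] →
        x < ((List.range n).map c ++ M).length := by
      intro x hx
      rcases hx with hx | hx
      · exact hM3 x hx
      · simp only [List.mem_append, List.mem_range, List.mem_singleton] at hx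
        rw [List.length_append, hXl]
        omega
    intro x y hx hy hxy
    have hx' := hb x hx
    have hy' := hb y hy
    simp only [hf] at hxy
    rw [List.getD_eq_getElem _ _ hx', List.getD_eq_getElem _ _ hy'] at hxy
    exact (hXM.getElem_inj_iff).1 hxy)
  have hKf : (List.range n ++ [0]).map f = C.support := by
    rw [hK]
    apply List.map_congr_left
    intro i hi
    apply hfc
    simp only [List.mem_append, List.mem_range, List.mem_singleton] at hi
    omega
  rw [hKf] at g1
  have hmem0 : ∀ i ∈ 0 :: R, c i ∈ (padL (gapB n e) (0 :: R) n).map f := by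
    intro i hi
    rw [← hfc i (hQn i hi)]
    exact List.mem_map_of_mem (mem_padL _ _ _ _ hi)
  refine Good.sublist hM4 [] (by simpa using hPn) ?_ ?_ g1
  · intro h
    have := hmem0 0 (by simp)
    rw [List.nil_append] at h
    rw [h] at this
    simp at this
  · intro x hx hxC
    have hxf : x ∈ (0 :: R).map c := by
      rw [hQ, List.mem_filter]
      exact ⟨by simpa using hx, by simpa using hxC⟩
    obtain ⟨i, hi, rfl⟩ := List.mem_map.1 hxf
    simpa using hmem0 i hi

/-- If a connected graph decomposes into a path `P` and a cycle `C` of length at most 5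
such that `P` contains at most three chords of `C`, then its path number is 2. -/
theorem pn_eq_two_path_cycle {V : Type} (G : SimpleGraph V) (hconn : G.Connected)
    {u v w : V} (P : G.Walk u v) (C : G.Walk w w)
    (hP : P.IsPath) (hC : C.IsCycle) (hlen : C.length ≤ 5)
    (hdisj : ∀ e ∈ P.edges, e ∉ C.edges)
    (hcover : ∀ e, e ∈ G.edgeSet ↔ e ∈ P.edges ∨ e ∈ C.edges)
    (hchord : {e : Sym2 V | e ∈ P.edges ∧ IsChord G C e}.ncard ≤ 3) :
    (∃ D, IsPathDecomp G D ∧ D.length = 2) ∧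
    (∀ D, IsPathDecomp G D → 2 ≤ D.length) := by
  classical
  constructor
  · have hmeet : ∃ x ∈ P.support, x ∈ C.support := by
      by_contra hcon
      push Not at hcon
      have key : ∀ (a b : V) (p : G.Walk a b), a ∈ C.support → b ∈ C.support := by
        intro a b p
        induction p with
        | nil => exact id
        | @cons a x b h p ih =>
          intro ha
          apply ih
          rcases (hcover s(a, x)).1 h with h | h
          · exact absurd ha (hcon a (P.fst_mem_support_of_mem_edges h))
          · exact C.snd_mem_support_of_mem_edges h
      obtain ⟨p⟩ := hconn.preconnected w u
      exact hcon u P.start_mem_support (key w u p C.start_mem_support)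
    obtain ⟨x, F, hF⟩ : ∃ x F, P.support.filter (fun x => decide (x ∈ C.support)) = x :: F := by
      obtain ⟨y, hy, hyC⟩ := hmeet
      have hne : P.support.filter (fun x => decide (x ∈ C.support)) ≠ [] := by
        apply List.ne_nil_of_mem (a := y)
        exact List.mem_filter.2 ⟨hy, by simpa using hyC⟩
      exact List.exists_cons_of_ne_nil hne
    have hx : x ∈ C.support := by
      have : x ∈ P.support.filter (fun x => decide (x ∈ C.support)) := by rw [hF]; simp
      simpa using (List.mem_filter.1 this).2
    have hE : ∀ e, e ∈ (C.rotate x hx).edges ↔ e ∈ C.edges :=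
      fun e => (C.rotate_edges x hx).mem_iff
    have hS : ∀ y, y ∈ (C.rotate x hx).support ↔ y ∈ C.support :=
      fun y => C.mem_support_rotate_iff x hx
    have hC' : (C.rotate x hx).IsCycle := by simpa using hC
    have hlen' : (C.rotate x hx).length ≤ 5 := by simpa using hlen
    obtain ⟨L₁, L₂, h1, h2, hp, -⟩ := good_main G P (C.rotate x hx) hP hC' hlen'
      (fun e he => by rw [hE]; exact hdisj e he)
      (by simpa only [IsChord, hE, hS] using hchord) F (by simpa only [hS] using hF)
    rw [← edges_eq_edgesL, ← edges_eq_edgesL] at hp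
    have hmem : ∀ e, e ∈ G.edgeSet ↔ e ∈ edgesL L₁ ∨ e ∈ edgesL L₂ := by
      intro e
      rw [hcover, ← List.mem_append (s := edgesL L₁), hp.mem_iff, List.mem_append, hE]
    have hnd : (edgesL L₁ ++ edgesL L₂).Nodup := by
      rw [hp.nodup_iff]
      refine List.Nodup.append hP.isTrail.edges_nodup hC'.isTrail.edges_nodup ?_
      intro e he he'
      exact hdisj e he ((hE e).1 he')
    obtain ⟨a, b, p, hp1, hp2⟩ := walk_of_list (G := G) w L₁ h1
      fun e he => (hmem e).2 (Or.inl he)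
    obtain ⟨a', b', q, hq1, hq2⟩ := walk_of_list (G := G) w L₂ h2
      fun e he => (hmem e).2 (Or.inr he)
    refine ⟨[⟨a, b, p⟩, ⟨a', b', q⟩], ⟨?_, ?_, ?_⟩, rfl⟩
    · intro r hr
      simp only [List.mem_cons, List.not_mem_nil, or_false] at hr
      rcases hr with rfl | rfl
      · exact hp1
      · exact hq1
    · intro e
      rw [hmem]
      simp [hp2, hq2]
    · simp only [List.pairwise_cons, List.mem_singleton, forall_eq, List.not_mem_nil,
        List.Pairwise.nil, hp2, hq2]
      refine ⟨fun e he he' => ?_, by simp⟩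
      exact (List.disjoint_of_nodup_append hnd) he he'
  · intro D hD
    obtain ⟨hD1, hD2, -⟩ := hD
    have h3 := hC.three_le_length
    match D, hD1, hD2 with
    | [], _, hD2 =>
      have := (hD2 _).1 (C.edges_subset_edgeSet (getVert_edge C 0 (by omega)))
      simp at this
    | [r], hD1, hD2 =>
      exfalso
      refine path_no_cycle r.2.2 (hD1 r (by simp)) w C hC fun e he => ?_
      have := (hD2 e).1 (C.edges_subset_edgeSet he)
      simpa using this
    | _ :: _ :: _, _, _ => simp
end

section
/- Let G be a connected Eulerian graph with treewidth at most 3 on n vertices (n ≥ 3). Then G admits a decomposition into at most floor((n-1)/2) cycles. -/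
/-- A cycle decomposition of `G`: a list of cycles of `G` whose edge sets are pairwise
disjoint and whose union is the edge set of `G`. -/
def IsCycleDecomp {V : Type} (G : SimpleGraph V)
    (C : List (Σ v : V, G.Walk v v)) : Prop :=
  (∀ c ∈ C, c.2.IsCycle) ∧
  (∀ e : Sym2 V, e ∈ G.edgeSet ↔ ∃ c ∈ C, e ∈ c.2.edges) ∧
  C.Pairwise (fun c d => ∀ e, e ∈ c.2.edges → e ∉ d.2.edges)

/-- `G` has treewidth at most `k`: there is a tree decomposition of `G` all of whose
bags have at most `k + 1` vertices. -/
def TreewidthLE {V : Type} (G : SimpleGraph V) (k : ℕ) : Prop :=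
  ∃ (ι : Type) (T : SimpleGraph ι) (B : ι → Finset V),
    T.IsTree ∧
    (∀ v : V, ∃ i, v ∈ B i) ∧
    (∀ u v : V, G.Adj u v → ∃ i, u ∈ B i ∧ v ∈ B i) ∧
    (∀ v : V, (T.induce {i : ι | v ∈ B i}).Connected) ∧
    (∀ i : ι, (B i).card ≤ k + 1)

namespace HajosTW

open SimpleGraph

variable {V : Type}

/-- Truncate a walk at the first vertex in `S`. -/
lemma first_hit {G : SimpleGraph V} (S : Set V) {a b : V} (p : G.Walk a b) (hb : b ∈ S) :
    ∃ y ∈ S, ∃ q : G.Walk a y, q.IsPath ∧ (∀ z ∈ q.support, z ∈ p.support) ∧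
      (∀ z ∈ q.support, z ∈ S → z = y) := by
  classical
  suffices H : ∃ y ∈ S, ∃ q : G.Walk a y, (∀ z ∈ q.support, z ∈ p.support) ∧
      (∀ z ∈ q.support, z ∈ S → z = y) by
    obtain ⟨y, hy, q, h1, h2⟩ := H
    exact ⟨y, hy, q.bypass, q.bypass_isPath, fun z hz => h1 z (q.support_bypass_subset_support hz),
      fun z hz => h2 z (q.support_bypass_subset_support hz)⟩
  induction p with
  | nil => exact ⟨_, hb, Walk.nil, by simp, by simp⟩
  | @cons u v w h p ih =>
    by_cases hu : u ∈ S
    · exact ⟨u, hu, Walk.nil, by simp, by simp⟩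
    · obtain ⟨y, hy, q, h1, h2⟩ := ih hb
      refine ⟨y, hy, Walk.cons h q, ?_, ?_⟩
      · intro z hz
        simp only [Walk.support_cons, List.mem_cons] at hz ⊢
        rcases hz with rfl | hz
        · exact Or.inl rfl
        · exact Or.inr (h1 z hz)
      · intro z hz hzS
        simp only [Walk.support_cons, List.mem_cons] at hz
        rcases hz with rfl | hz
        · exact absurd hzS hu
        · exact h2 z hz hzS

/-- Appending two paths meeting only at the joint gives a path. -/
lemma path_append {G : SimpleGraph V} {a b c : V} {p : G.Walk a b} {q : G.Walk b c}
    (hp : p.IsPath) (hq : q.IsPath) (h : ∀ z ∈ p.support, z ∈ q.support → z = b) :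
    (p.append q).IsPath := by
  rw [Walk.isPath_def, Walk.support_append, List.nodup_append']
  have hq' := hq.support_nodup
  rw [← Walk.cons_tail_support] at hq'
  refine ⟨hp.support_nodup, (List.nodup_cons.1 hq').2, ?_⟩
  intro z hz hz'
  have := h z hz (List.mem_of_mem_tail hz')
  subst this
  exact (List.nodup_cons.1 hq').1 hz'

lemma arc {G : SimpleGraph V} {u y v : V} {c : G.Walk u u} (hc : c.IsCycle)
    (hy : y ∈ c.support) (hv : v ∈ c.support) (hyu : y ≠ u) :
    ∃ P : G.Walk u y, P.IsPath ∧ v ∈ P.support ∧ ∀ z ∈ P.support, z ∈ c.support := by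
  classical
  have h1 := hc.isPath_takeUntil hy
  have h2 : (c.dropUntil y hy).IsPath := by
    have := hc
    rw [← c.take_spec hy] at this
    exact this.isPath_of_append_right (Walk.not_nil_of_ne hyu.symm)
  have hv' := hv
  rw [← c.take_spec hy, Walk.mem_support_append_iff] at hv'
  rcases hv' with hv' | hv'
  · exact ⟨_, h1, hv', fun z hz => c.support_takeUntil_subset_support hy hz⟩
  · exact ⟨_, h2.reverse, by simpa using hv', fun z hz =>
      c.support_dropUntil_subset_support hy (by simpa using hz)⟩

/-- Whitney: in a non-separable graph any two vertices lie on a common cycle. -/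
lemma whitney {G : SimpleGraph V} (S : Set V) (hS : ∀ a b, G.Adj a b → a ∈ S)
    (hns : ∀ a b x, a ∈ S → b ∈ S → x ≠ a → x ≠ b → ∃ p : G.Walk a b, x ∉ p.support)
    {u v : V} (p : G.Walk u v) (hdeg : ∀ u, ∃ x, G.Adj v x ∧ x ≠ u) (huv : u ≠ v) :
    ∃ (z : V) (c : G.Walk z z), c.IsCycle ∧ u ∈ c.support ∧ v ∈ c.support := by
  classical
  induction p with
  | nil => exact absurd rfl huv
  | @cons u u' v h p ih =>
    by_cases hu' : u' = v
    · subst hu'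
      obtain ⟨x, hx, hxu⟩ := hdeg u
      obtain ⟨q, hq⟩ := hns x u u' (hS _ _ hx.symm) (hS _ _ h) hx.ne huv.symm
      have hqb : u' ∉ q.bypass.support := fun hh => hq (q.support_bypass_subset_support hh)
      refine ⟨u, Walk.cons h (Walk.cons hx q.bypass), ?_, by simp, by simp⟩
      rw [Walk.cons_isCycle_iff, Walk.cons_isPath_iff]
      refine ⟨⟨q.bypass_isPath, hqb⟩, ?_⟩
      simp only [Walk.edges_cons, List.mem_cons, not_or]
      refine ⟨?_, fun hh => hqb (Walk.snd_mem_support_of_mem_edges _ hh)⟩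
      intro hh
      simp only [Sym2.eq_iff] at hh
      rcases hh with ⟨h1, _⟩ | ⟨h1, _⟩
      · exact huv h1
      · exact hxu h1.symm
    · obtain ⟨z, c, hc, h1, h2⟩ := ih hdeg hu'
      by_cases huc : u ∈ c.support
      · exact ⟨z, c, hc, huc, h2⟩
      obtain ⟨x, hx, -⟩ := hdeg u
      obtain ⟨q, hq⟩ := hns u v u' (hS _ _ h) (hS _ _ hx) h.ne' hu'
      obtain ⟨y, hy, q', hq', hs, hd⟩ := first_hit {w | w ∈ c.support} q h2
      have hyu : y ≠ u' := fun hh => hq (hh ▸ hs y q'.end_mem_support)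
      have hc' : (c.rotate u' h1).IsCycle := hc.rotate h1
      have hmem : ∀ w, w ∈ (c.rotate u' h1).support ↔ w ∈ c.support := fun w => by simp
      obtain ⟨P, hP, hvP, hPs⟩ := arc hc' ((hmem y).2 hy) ((hmem v).2 h2) hyu
      have hpath : (P.append q'.reverse).IsPath := by
        refine path_append hP hq'.reverse ?_
        intro w hw hw'
        exact hd w (by simpa using hw') ((hmem w).1 (hPs w hw))
      refine ⟨u, Walk.cons h (P.append q'.reverse), ?_, by simp, by simp [hvP]⟩
      rw [Walk.cons_isCycle_iff]
      refine ⟨hpath, ?_⟩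
      rw [Walk.edges_append, List.mem_append, not_or]
      refine ⟨fun hh => ?_, fun hh => ?_⟩
      · exact huc ((hmem u).1 (hPs u (Walk.fst_mem_support_of_mem_edges _ hh)))
      · have := Walk.snd_mem_support_of_mem_edges _ hh
        exact hq (hs u' (by simpa using this))

/-- Root-to-subtree paths in a tree. -/
lemma tree_top {ι : Type} {T : SimpleGraph ι} (hT : T.IsTree) (r : ι) (s : Set ι)
    (hs : (T.induce s).Connected) :
    ∃ j ∈ s, ∃ q : T.Walk r j, ∀ i ∈ s, ∃ t : T.Walk j i,
      (∀ z ∈ t.support, z ∈ s) ∧ (q.append t).IsPath := by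
  classical
  obtain ⟨⟨i0, hi0⟩⟩ := hs.nonempty
  obtain ⟨p⟩ := hT.connected.preconnected r i0
  obtain ⟨j, hj, q, hq, -, hd⟩ := first_hit s p hi0
  refine ⟨j, hj, q, fun i hi => ?_⟩
  obtain ⟨w⟩ := hs.preconnected ⟨j, hj⟩ ⟨i, hi⟩
  let w' : T.Walk j i := w.map (Embedding.induce s).toHom
  have hw' : ∀ z ∈ w'.support, z ∈ s := by
    intro z hz
    rw [show w'.support = _ from Walk.support_map _ _, List.mem_map] at hz
    obtain ⟨a, -, rfl⟩ := hz
    exact a.2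
  have hb : ∀ z ∈ w'.bypass.support, z ∈ s := fun z hz => hw' z (w'.support_bypass_subset_support hz)
  exact ⟨w'.bypass, hb, path_append hq w'.bypass_isPath fun z hz hz' => hd z hz (hb z hz')⟩

/-- A deepest vertex with respect to the root `r`. -/
lemma deepest {ι : Type} {T : SimpleGraph ι} (B : ι → Finset V) (hT : T.IsTree)
    (hB : ∀ v : V, (T.induce {i : ι | v ∈ B i}).Connected)
    (S : Finset V) (hS : S.Nonempty) (r : ι) :
    ∃ v ∈ S, ∃ j, v ∈ B j ∧ (∀ u ∈ S, (∃ i, u ∈ B i ∧ v ∈ B i) → u ∈ B j) ∧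
      (v ∈ B r → ∀ u ∈ S, u ∈ B r) := by
  classical
  choose j hj q hq using fun v => tree_top hT r _ (hB v)
  obtain ⟨v, hv, hmax⟩ := S.exists_max_image (fun v => (q v).length) hS
  refine ⟨v, hv, j v, hj v, ?_, ?_⟩
  · rintro u hu ⟨i, hui, hvi⟩
    obtain ⟨t, ht, hp⟩ := hq v i hvi
    obtain ⟨t', ht', hp'⟩ := hq u i hui
    have heq : (q v).append t = (q u).append t' := (hT.existsUnique_path _ _).unique hp hp'
    have h1 : ((q v).append t).getVert (q v).length = j v := by
      rw [Walk.getVert_append]; simp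
    rw [heq, Walk.getVert_append, if_neg (not_lt.2 (hmax u hu))] at h1
    have : j v ∈ t'.support := h1 ▸ Walk.getVert_mem_support _ _
    exact ht' _ this
  · intro hvr u hu
    obtain ⟨t, ht, hp⟩ := hq v r hvr
    have h0 : ((q v).append t) = Walk.nil := (hT.existsUnique_path _ _).unique hp Walk.IsPath.nil
    have h1 : ((q v).append t).length = 0 := by rw [h0]; rfl
    rw [Walk.length_append] at h1
    have h2 := hmax u hu
    have h3 : (q u).length = 0 := by omega
    have h4 : r = j u := Walk.eq_of_length_eq_zero h3
    rw [h4]; exact hj u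

/-- Two vertices of small degree. -/
lemma two_small {ι : Type} {T : SimpleGraph ι} (B : ι → Finset V) (hT : T.IsTree)
    (hB : ∀ v : V, (T.induce {i : ι | v ∈ B i}).Connected)
    (hc : ∀ i, (B i).card ≤ 4) (G : SimpleGraph V)
    (hG : ∀ u v : V, G.Adj u v → ∃ i, u ∈ B i ∧ v ∈ B i)
    (S : Finset V) (hS : 2 ≤ S.card) (hGS : ∀ a b, G.Adj a b → a ∈ S) :
    ∃ v ∈ S, ∃ w ∈ S, v ≠ w ∧ (G.neighborSet v).ncard ≤ 3 ∧ (G.neighborSet w).ncard ≤ 3 := by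
  classical
  have key : ∀ v j, v ∈ B j → (∀ u, G.Adj v u → u ∈ B j) → (G.neighborSet v).ncard ≤ 3 := by
    intro v j hv h
    have h1 : G.neighborSet v ⊆ ((B j).erase v : Finset V) := by
      intro u hu
      have hu' : G.Adj v u := hu
      simp [hu'.ne', h u hu']
    have h2 := Set.ncard_le_ncard h1 (Finset.finite_toSet _)
    rw [Set.ncard_coe_finset, Finset.card_erase_of_mem hv] at h2
    have := hc j
    omega
  have hne : S.Nonempty := Finset.card_pos.1 (by omega)
  have key2 : ∀ v ∈ S, ∀ j, v ∈ B j → (∀ u ∈ S, (∃ i, u ∈ B i ∧ v ∈ B i) → u ∈ B j) →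
      (G.neighborSet v).ncard ≤ 3 := fun v _ j hv h =>
    key v j hv fun u hu => h u (hGS _ _ hu.symm) (hG _ _ hu.symm)
  obtain ⟨r0⟩ := hT.connected.nonempty
  obtain ⟨v, hv, j, hvj, hj, -⟩ := deepest B hT hB S hne r0
  obtain ⟨w, hw, k, hwk, hk, hk0⟩ := deepest B hT hB S hne j
  by_cases hwj : w ∈ B j
  · have hall := hk0 hwj
    obtain ⟨a, ha, b, hb, hab⟩ := Finset.one_lt_card.1 (show 1 < S.card by omega)
    exact ⟨a, ha, b, hb, hab, key a j (hall a ha) fun u hu => hall u (hGS _ _ hu.symm),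
      key b j (hall b hb) fun u hu => hall u (hGS _ _ hu.symm)⟩
  · exact ⟨v, hv, w, hw, fun h => hwj (h ▸ hvj), key2 v hv j hvj hj, key2 w hw k hwk hk⟩

/-- The edge set `E` decomposes into at most `k` cycles of `G`. -/
def PD (G : SimpleGraph V) (E : Set (Sym2 V)) (k : ℕ) : Prop :=
  ∃ C : List (Σ v : V, G.Walk v v), (∀ c ∈ C, c.2.IsCycle) ∧
    (∀ e : Sym2 V, e ∈ E ↔ ∃ c ∈ C, e ∈ c.2.edges) ∧
    C.Pairwise (fun c d => ∀ e, e ∈ c.2.edges → e ∉ d.2.edges) ∧ C.length ≤ k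

lemma PD.union {G : SimpleGraph V} {E F : Set (Sym2 V)} {k l : ℕ} (h1 : PD G E k) (h2 : PD G F l)
    (hd : ∀ e, e ∈ E → e ∉ F) : PD G (E ∪ F) (k + l) := by
  obtain ⟨C, c1, c2, c3, c4⟩ := h1
  obtain ⟨D, d1, d2, d3, d4⟩ := h2
  refine ⟨C ++ D, ?_, ?_, ?_, ?_⟩
  · intro c hc
    rcases List.mem_append.1 hc with h | h
    · exact c1 c h
    · exact d1 c h
  · intro e
    rw [Set.mem_union, c2, d2]
    simp only [List.mem_append, or_and_right, exists_or]
  · rw [List.pairwise_append]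
    refine ⟨c3, d3, fun c hc d hd' e he he' => ?_⟩
    exact hd e ((c2 e).2 ⟨c, hc, he⟩) ((d2 e).2 ⟨d, hd', he'⟩)
  · rw [List.length_append]; omega

lemma PD.mono {G H : SimpleGraph V} {E : Set (Sym2 V)} {k : ℕ} (h : PD H E k) (hle : H ≤ G) :
    PD G E k := by
  obtain ⟨C, c1, c2, c3, c4⟩ := h
  refine ⟨C.map (fun c => ⟨c.1, c.2.mapLe hle⟩), ?_, ?_, ?_, ?_⟩
  · intro c hc
    obtain ⟨d, hd, rfl⟩ := List.mem_map.1 hc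
    exact (c1 d hd).mapLe hle
  · intro e
    rw [c2]
    constructor
    · rintro ⟨c, hc, he⟩
      exact ⟨_, List.mem_map.2 ⟨c, hc, rfl⟩, by simpa using he⟩
    · rintro ⟨d, hd, he⟩
      obtain ⟨c, hc, rfl⟩ := List.mem_map.1 hd
      exact ⟨c, hc, by simpa using he⟩
  · rw [List.pairwise_map]
    simpa using c3
  · simpa using c4

lemma PD.single {G : SimpleGraph V} {z : V} {c : G.Walk z z} (hc : c.IsCycle) :
    PD G {e | e ∈ c.edges} 1 :=
  ⟨[⟨z, c⟩], by simpa using hc, by simp, by simp, by simp⟩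

lemma PD.bot (G : SimpleGraph V) (k : ℕ) : PD G ∅ k :=
  ⟨[], by simp, by simp, by simp, by simp⟩

/-- If all vertices except possibly one have even degree, so does the last one. -/
lemma even_last [Finite V] (G : SimpleGraph V) (x : V)
    (h : ∀ u, u ≠ x → Even (G.neighborSet u).ncard) : Even (G.neighborSet x).ncard := by
  classical
  have := Fintype.ofFinite V
  have hd : ∀ u, (G.neighborSet u).ncard = G.degree u := by
    intro u
    rw [Set.ncard_eq_toFinset_card', ← SimpleGraph.card_neighborSet_eq_degree, Set.toFinset_card]
  rw [hd]
  by_contra hx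
  have h1 := G.odd_card_odd_degree_vertices_ne x (Nat.not_even_iff_odd.1 hx)
  rw [Finset.filter_false_of_mem] at h1
  · simp at h1
  · rintro u - ⟨hu, ho⟩
    have := h u hu
    rw [hd] at this
    exact Nat.not_even_iff_odd.2 ho this

lemma main [Finite V] {ι : Type} {T : SimpleGraph ι} (B : ι → Finset V) (hT : T.IsTree)
    (hB : ∀ v : V, (T.induce {i : ι | v ∈ B i}).Connected)
    (hc : ∀ i, (B i).card ≤ 4) (n : ℕ) : ∀ (S : Finset V) (G : SimpleGraph V),
    S.card = n → S.Nonempty →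
    (∀ u v : V, G.Adj u v → ∃ i, u ∈ B i ∧ v ∈ B i) →
    (∀ a b, G.Adj a b → a ∈ S) → (∀ v, Even (G.neighborSet v).ncard) →
    PD G G.edgeSet ((n - 1) / 2) := by
  classical
  induction n using Nat.strong_induction_on with
  | _ n ih =>
  intro S G hn hne hG hGS hev
  by_cases hbot : G = ⊥
  · subst hbot
    rw [edgeSet_bot]; exact PD.bot _ _
  by_cases hns : ∀ a b x, a ∈ (S : Set V) → b ∈ (S : Set V) → x ≠ a → x ≠ b →
      ∃ p : G.Walk a b, x ∉ p.support
  · -- nonseparable case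
    obtain ⟨u0, v0, h0⟩ : ∃ u v, G.Adj u v := by
      by_contra! hh
      exact hbot (by ext u v; simp [hh u v])
    -- a nonisolated vertex has two neighbours
    have hnb : ∀ u v, G.Adj u v → ∀ y, ∃ x, G.Adj u x ∧ x ≠ y := by
      intro u v huv y
      by_contra! hh
      have hv : v = y := hh v huv
      have : G.neighborSet u = {y} := by
        ext w
        simp only [mem_neighborSet, Set.mem_singleton_iff]
        exact ⟨hh w, fun h => by rw [h, ← hv]; exact huv⟩
      have h1 := hev u
      rw [this] at h1
      simp at h1
    obtain ⟨w0, hw0, hw0'⟩ := hnb u0 v0 h0 v0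
    have h3 : 3 ≤ S.card := by
      have hsub : ({u0, v0, w0} : Finset V) ⊆ S := by
        intro z hz
        simp only [Finset.mem_insert, Finset.mem_singleton] at hz
        rcases hz with rfl | rfl | rfl
        · exact hGS _ _ h0
        · exact hGS _ _ h0.symm
        · exact hGS _ _ hw0.symm
      have h4 := Finset.card_le_card hsub
      rwa [Finset.card_eq_three.2 ⟨u0, v0, w0, h0.ne, hw0.ne, hw0'.symm, rfl⟩] at h4
    obtain ⟨v, hv, w, hw, hvw, dv, dw⟩ := two_small B hT hB hc G hG S (by omega) hGS
    obtain ⟨y, hy⟩ : ∃ y ∈ S, y ≠ v ∧ y ≠ w := by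
      by_contra! hh
      have hsub : S ⊆ {v, w} := by
        intro z hz
        simp only [Finset.mem_insert, Finset.mem_singleton]
        by_contra! h5
        exact h5.2 (hh z hz h5.1)
      have := (Finset.card_le_card hsub).trans Finset.card_le_two
      omega
    obtain ⟨p, -⟩ := hns w v y hw hv hy.2.2 hy.2.1
    have hadj : ∀ a b (p : G.Walk a b), a ≠ b → ∃ x, G.Adj a x := by
      intro a b p hab
      cases p with
      | nil => exact absurd rfl hab
      | cons h p => exact ⟨_, h⟩
    obtain ⟨v1, hv1⟩ := hadj v w p.reverse hvw
    obtain ⟨z, c, hcyc, hwc, hvc⟩ := whitney (S : Set V) hGS hns p (hnb v v1 hv1) hvw.symm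
    let G' := G.deleteEdges {e | e ∈ c.edges}
    have hle : G' ≤ G := deleteEdges_le _
    have hsplit : ∀ u, (G'.neighborSet u).ncard + (c.toSubgraph.neighborSet u).ncard
        = (G.neighborSet u).ncard := by
      intro u
      rw [← Set.ncard_union_eq _ (Set.toFinite _) (Set.toFinite _)]
      · congr 1
        ext x
        simp only [G', Set.mem_union, mem_neighborSet, deleteEdges_adj, Subgraph.mem_neighborSet,
          Walk.adj_toSubgraph_iff_mem_edges, Set.mem_ofPred_eq]
        constructor
        · rintro (h | h)
          · exact h.1
          · exact Walk.adj_of_mem_edges _ h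
        · intro h
          by_cases h' : s(u, x) ∈ c.edges
          · exact Or.inr h'
          · exact Or.inl ⟨h, h'⟩
      · rw [Set.disjoint_left]
        intro x hx hx'
        simp only [G', mem_neighborSet, deleteEdges_adj, Subgraph.mem_neighborSet,
          Walk.adj_toSubgraph_iff_mem_edges, Set.mem_ofPred_eq] at hx hx'
        exact hx.2 hx'
    have hiso : ∀ u, (G.neighborSet u).ncard ≤ 3 → u ∈ c.support → ∀ x, ¬ G'.Adj u x := by
      intro u hu huc x hx
      have h1 := hsplit u
      rw [hcyc.ncard_neighborSet_toSubgraph_eq_two huc] at h1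
      have h2 : 0 < (G'.neighborSet u).ncard := (Set.ncard_pos (Set.toFinite _)).2 ⟨x, hx⟩
      obtain ⟨k, hk⟩ := hev u
      omega
    have hcard : ((S.erase v).erase w).card = n - 2 := by
      rw [Finset.card_erase_of_mem (Finset.mem_erase.2 ⟨hvw.symm, hw⟩), Finset.card_erase_of_mem hv]
      omega
    have hrec := ih (n - 2) (by omega) ((S.erase v).erase w) G' hcard
      (Finset.card_pos.1 (by omega)) (fun a b h => hG a b (hle h))
      (by
        intro a b h
        rw [Finset.mem_erase, Finset.mem_erase]
        refine ⟨?_, ?_, hGS a b (hle h)⟩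
        · rintro rfl; exact hiso _ dw hwc b h
        · rintro rfl; exact hiso _ dv hvc b h)
      (by
        intro u
        have h1 := hsplit u
        have h2 := hev u
        by_cases huc : u ∈ c.support
        · rw [hcyc.ncard_neighborSet_toSubgraph_eq_two huc] at h1
          obtain ⟨k, hk⟩ := h2
          exact ⟨k - 1, by omega⟩
        · have : c.toSubgraph.neighborSet u = ∅ := by
            ext x
            simp only [Subgraph.mem_neighborSet, Walk.adj_toSubgraph_iff_mem_edges,
              Set.mem_empty_iff_false, iff_false]
            exact fun h => huc (Walk.fst_mem_support_of_mem_edges _ h)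
          rw [this, Set.ncard_empty, add_zero] at h1
          rwa [h1])
    have hfin := (hrec.mono hle).union (PD.single hcyc) (by
      intro e he
      simp only [G', edgeSet_deleteEdges] at he
      exact he.2)
    have hE : G'.edgeSet ∪ {e | e ∈ c.edges} = G.edgeSet := by
      simp only [G', edgeSet_deleteEdges]
      exact Set.sdiff_union_of_subset fun e he => c.edges_subset_edgeSet he
    rw [hE] at hfin
    have hk : (n - 2 - 1) / 2 + 1 = (n - 1) / 2 := by omega
    rwa [hk] at hfin
  · -- separable case
    push Not at hns
    obtain ⟨a, b, x, ha, hb, hxa, hxb, hab⟩ := hns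
    obtain ⟨R, hR⟩ : ∃ R : Set V, ∀ y, y ∈ R ↔ ∃ p : G.Walk a y, x ∉ p.support :=
      ⟨{y | ∃ p : G.Walk a y, x ∉ p.support}, fun y => Iff.rfl⟩
    have haR : a ∈ R := (hR a).2 ⟨Walk.nil, by simpa using hxa⟩
    have hbR : b ∉ R := fun h => by
      obtain ⟨p, hp⟩ := (hR b).1 h
      exact hp (hab p)
    have hcl : ∀ u w, u ∈ R → G.Adj u w → w ≠ x → w ∈ R := by
      intro u w hu huw hwx
      obtain ⟨p, hp⟩ := (hR u).1 hu
      exact (hR w).2 ⟨p.concat huw, by simp [Walk.support_concat, hp, hwx.symm]⟩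
    let G1 : SimpleGraph V :=
      { Adj := fun u v => G.Adj u v ∧ (u ∈ R ∨ v ∈ R)
        symm := ⟨fun u v h => ⟨h.1.symm, h.2.symm⟩⟩
        loopless := ⟨fun u h => h.1.ne rfl⟩ }
    let G2 : SimpleGraph V :=
      { Adj := fun u v => G.Adj u v ∧ ¬ (u ∈ R ∨ v ∈ R)
        symm := ⟨fun u v h => ⟨h.1.symm, fun h' => h.2 h'.symm⟩⟩
        loopless := ⟨fun u h => h.1.ne rfl⟩ }
    have hle1 : G1 ≤ G := fun u v h => h.1
    have hle2 : G2 ≤ G := fun u v h => h.1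
    have hsplit : ∀ u, (G1.neighborSet u).ncard + (G2.neighborSet u).ncard
        = (G.neighborSet u).ncard := by
      intro u
      rw [← Set.ncard_union_eq _ (Set.toFinite _) (Set.toFinite _)]
      · congr 1
        ext y
        change (G.Adj u y ∧ (u ∈ R ∨ y ∈ R)) ∨ (G.Adj u y ∧ ¬ (u ∈ R ∨ y ∈ R)) ↔ G.Adj u y
        tauto
      · rw [Set.disjoint_left]
        exact fun y hy hy' => hy'.2 hy.2
    have hev1 : ∀ u, Even (G1.neighborSet u).ncard := by
      have h1 : ∀ u, u ≠ x → Even (G1.neighborSet u).ncard := by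
        intro u hux
        by_cases hu : u ∈ R
        · have : G1.neighborSet u = G.neighborSet u := by
            ext y
            exact ⟨fun h => h.1, fun h => ⟨h, Or.inl hu⟩⟩
          rw [this]; exact hev u
        · have : G1.neighborSet u = ∅ := by
            ext y
            simp only [Set.mem_empty_iff_false, iff_false]
            rintro ⟨h, h' | h'⟩
            · exact hu h'
            · exact hu (hcl y u h' h.symm hux)
          rw [this]; simp
      intro u
      by_cases hux : u = x
      · rw [hux]; exact even_last G1 x h1
      · exact h1 u hux
    have hev2 : ∀ u, Even (G2.neighborSet u).ncard := by
      intro u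
      obtain ⟨k, hk⟩ := hev u
      obtain ⟨l, hl⟩ := hev1 u
      have := hsplit u
      exact ⟨k - l, by omega⟩
    let S1 := S.filter (fun y => y ∈ R ∨ y = x)
    let S2 := S.filter (fun y => y ∉ R)
    have haS1 : a ∈ S1 := Finset.mem_filter.2 ⟨ha, Or.inl haR⟩
    have hbS2 : b ∈ S2 := Finset.mem_filter.2 ⟨hb, hbR⟩
    have hlt1 : S1.card < n := by
      rw [← hn]
      refine Finset.card_lt_card ⟨Finset.filter_subset _ _, fun h => ?_⟩
      rcases (Finset.mem_filter.1 (h hb)).2 with h | h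
      · exact hbR h
      · exact hxb h.symm
    have hlt2 : S2.card < n := by
      rw [← hn]
      refine Finset.card_lt_card ⟨Finset.filter_subset _ _, fun h => ?_⟩
      exact (Finset.mem_filter.1 (h ha)).2 haR
    have hsum : S1.card + S2.card ≤ n + 1 := by
      have h1 : S1 ⊆ insert x (S.filter (fun y => y ∈ R)) := by
        intro y hy
        rcases (Finset.mem_filter.1 hy).2 with h | h
        · exact Finset.mem_insert_of_mem (Finset.mem_filter.2 ⟨(Finset.mem_filter.1 hy).1, h⟩)
        · exact h ▸ Finset.mem_insert_self _ _
      have h2 := (Finset.card_le_card h1).trans (Finset.card_insert_le _ _)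
      have h3 := Finset.card_filter_add_card_filter_not (s := S) (fun y => y ∈ R)
      change _ + S2.card = _ at h3
      omega
    have r1 := ih S1.card hlt1 S1 G1 rfl ⟨a, haS1⟩ (fun u v h => hG u v h.1)
      (by
        rintro u v ⟨h, h'⟩
        refine Finset.mem_filter.2 ⟨hGS u v h, ?_⟩
        by_contra! h''
        rcases h' with h' | h'
        · exact h''.1 h'
        · exact h''.1 (hcl v u h' h.symm h''.2)) hev1
    have r2 := ih S2.card hlt2 S2 G2 rfl ⟨b, hbS2⟩ (fun u v h => hG u v h.1)
      (by
        rintro u v ⟨h, h'⟩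
        exact Finset.mem_filter.2 ⟨hGS u v h, fun h'' => h' (Or.inl h'')⟩) hev2
    have hfin := (r1.mono hle1).union (r2.mono hle2) (by
      intro e
      induction e with
      | _ u v => exact fun h h' => h'.2 h.2)
    have hE : G1.edgeSet ∪ G2.edgeSet = G.edgeSet := by
      ext e
      induction e with
      | _ u v =>
        change (G.Adj u v ∧ (u ∈ R ∨ v ∈ R)) ∨ (G.Adj u v ∧ ¬ (u ∈ R ∨ v ∈ R)) ↔ G.Adj u v
        tauto
    rw [hE] at hfin
    have p1 : 0 < S1.card := Finset.card_pos.2 ⟨a, haS1⟩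
    have p2 : 0 < S2.card := Finset.card_pos.2 ⟨b, hbS2⟩
    obtain ⟨C, c1, c2, c3, c4⟩ := hfin
    exact ⟨C, c1, c2, c3, by omega⟩

end HajosTW

/-- Hajós'\'' conjecture for graphs of treewidth at most 3: a connected Eulerian such graph
on `n ≥ 3` vertices has a cycle decomposition of size at most `⌊(n-1)/2⌋`. -/
theorem hajos_treewidth_le_three {V : Type} [Fintype V] (G : SimpleGraph V)
    (hconn : G.Connected) (heven : ∀ v : V, Even ((G.neighborSet v).ncard))
    (htw : TreewidthLE G 3) (hcard : 3 ≤ Fintype.card V) :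
    ∃ C, IsCycleDecomp G C ∧ C.length ≤ (Fintype.card V - 1) / 2 := by
  obtain ⟨ι, T, B, hT, -, hG, hB, hc⟩ := htw
  have hne : (Finset.univ : Finset V).Nonempty := Finset.card_pos.1 (by rw [Finset.card_univ]; omega)
  obtain ⟨C, c1, c2, c3, c4⟩ := HajosTW.main B hT hB hc _ Finset.univ G rfl hne hG
    (fun a _ _ => Finset.mem_univ a) heven
  exact ⟨C, ⟨c1, c2, c3⟩, c4⟩
end
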